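/- Let (X, μ, T₁, T₂) be a magic system on a standard Borel space with countably generated σ-algebra, and let x ↦ μₓ be an ergodic decomposition of μ under T₁ and T₂. Then for μ-almost every x, the system (X, μₓ, T₁, T₂) is magic. -/

import Mathlib

open MeasureTheory Filter

/-- The σ-algebra `ℐ(T)` of `T`-invariant measurable sets. -/
def invSigma {X : Type*} [m : MeasurableSpace X] (T : X → X) : MeasurableSpace X where
  MeasurableSet' s := MeasurableSet s ∧ T ⁻¹' s = s
  measurableSet_empty := ⟨MeasurableSet.empty, rfl⟩
  measurableSet_compl s hs := ⟨hs.1.compl, by rw [Set.preimage_compl, hs.2]⟩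
  measurableSet_iUnion f hf :=
    ⟨MeasurableSet.iUnion fun i => (hf i).1, by
      rw [Set.preimage_iUnion]
      exact Set.iUnion_congr fun i => (hf i).2⟩

/-- The box average of `f` with respect to `(T₁, T₂)` equals `L`: for every
`n₂` the inner Cesàro limit `c n₂` exists, and the Cesàro averages of `c`
converge to `L`. -/
def HasBoxAvg {X : Type*} [MeasurableSpace X] (μ : Measure X)
    (T₁ T₂ : X → X) (f : X → ℝ) (L : ℝ) : Prop :=
  ∃ c : ℕ → ℝ,
    (∀ n₂ : ℕ, Tendsto (fun N₁ : ℕ =>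
        (∑ n₁ ∈ Finset.range N₁,
          ∫ x, f x * f (T₁^[n₁] x) * f (T₂^[n₂] x) * f (T₁^[n₁] (T₂^[n₂] x)) ∂μ)
          / (N₁ : ℝ))
      atTop (nhds (c n₂))) ∧
    Tendsto (fun N₂ : ℕ => (∑ n₂ ∈ Finset.range N₂, c n₂) / (N₂ : ℝ))
      atTop (nhds L)

/-- A system is magic if every bounded measurable function whose conditional
expectation on `ℐ(T₁) ∨ ℐ(T₂)` vanishes has box average `0`. -/
def IsMagic {X : Type*} [MeasurableSpace X] (μ : Measure X) (T₁ T₂ : X ≃ᵐ X) : Prop :=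
  ∀ f : X → ℝ, Measurable f → (∃ C : ℝ, ∀ x, |f x| ≤ C) →
    (μ[f | invSigma ⇑T₁ ⊔ invSigma ⇑T₂] =ᵐ[μ] 0) →
    HasBoxAvg μ ⇑T₁ ⇑T₂ f 0


open scoped InnerProductSpace

/-- Mean ergodic theorem for the correlations `⟪F, Uᵐ F⟫`: their Cesàro averages converge, and the
limit controls the inner product of `F` with every fixed vector of `U`. -/
lemma exists_tendsto_cesaro_inner_iterate {H : Type*} [NormedAddCommGroup H]
    [InnerProductSpace ℝ H] [CompleteSpace H] (U : H →ₗᵢ[ℝ] H) (F : H) :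
    ∃ c : ℝ, 0 ≤ c ∧
      Tendsto (fun M : ℕ => (∑ m ∈ Finset.range M, ⟪F, U^[m] F⟫_ℝ) / (M : ℝ)) atTop (nhds c) ∧
      ∀ G, U G = G → ⟪F, G⟫_ℝ ^ 2 ≤ c * ‖G‖ ^ 2 := by
  let V : H →L[ℝ] H := U.toContinuousLinearMap
  have hV := V.tendsto_birkhoffAverage_orthogonalProjection U.norm_toContinuousLinearMap_le F
  set W : Submodule ℝ H := V.eqLocus (1 : H →L[ℝ] H)
  set P : H := (W.orthogonalProjectionOnto F : H)
  have hP : ∀ G ∈ W, ⟪F, G⟫_ℝ = ⟪P, G⟫_ℝ := fun G hG => by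
    rw [← sub_eq_zero, ← inner_sub_left]
    exact W.starProjection_inner_eq_zero F G hG
  have hPP : ⟪F, P⟫_ℝ = ‖P‖ ^ 2 := by
    rw [hP P (W.orthogonalProjectionOnto F).2, real_inner_self_eq_norm_sq]
  refine ⟨‖P‖ ^ 2, by positivity, ?_, fun G hG => ?_⟩
  · rw [← hPP]
    refine ((tendsto_const_nhds (x := F)).inner (𝕜 := ℝ) hV).congr fun M => ?_
    have : (V : H → H) = U := rfl
    simp only [birkhoffAverage, birkhoffSum, inner_smul_right, inner_sum, this, id]
    ring
  · rw [hP G hG, ← mul_pow]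
    exact sq_le_sq' (neg_le_of_abs_le (abs_real_inner_le_norm P G)) (real_inner_le_norm P G)

lemma norm_sq_sum_iterate {H : Type*} [NormedAddCommGroup H] [InnerProductSpace ℝ H]
    (U : H →ₗᵢ[ℝ] H) (g : H) (N : ℕ) :
    ‖∑ i ∈ Finset.range N, U^[i] g‖ ^ 2 = ∑ j ∈ Finset.range N,
      (2 * ∑ n ∈ Finset.range (j + 1), ⟪g, U^[n] g⟫_ℝ - ‖g‖ ^ 2) := by
  induction N with
  | zero => simp
  | succ N ih =>
    have h1 : ∑ i ∈ Finset.range (N + 1), U^[i] g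
        = g + U (∑ i ∈ Finset.range N, U^[i] g) := by
      rw [Finset.sum_range_succ', map_sum, add_comm]
      simp only [Function.iterate_succ_apply', Function.iterate_zero, id]
    rw [Finset.sum_range_succ (fun j => 2 * ∑ n ∈ Finset.range (j + 1), ⟪g, U^[n] g⟫_ℝ - ‖g‖ ^ 2),
      ← ih, Finset.sum_range_succ' (fun n => ⟪g, U^[n] g⟫_ℝ) N, h1, norm_add_sq_real,
      U.norm_map, map_sum, inner_sum]
    simp only [Function.iterate_succ_apply', Function.iterate_zero, id,
      real_inner_self_eq_norm_sq]
    ring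

/-- Averages of an orbit of an isometry over a long interval are bounded by averages over a
short one. -/
lemma mul_norm_sum_iterate_le {H : Type*} [NormedAddCommGroup H] [InnerProductSpace ℝ H]
    (U : H →ₗᵢ[ℝ] H) (g : H) (N M : ℕ) :
    N * ‖∑ i ∈ Finset.range M, U^[i] g‖
      ≤ M * ‖∑ i ∈ Finset.range N, U^[i] g‖ + 2 * N ^ 2 * ‖g‖ := by
  set S := ∑ i ∈ Finset.range M, U^[i] g with hS
  have hnorm : ∀ (j : ℕ) (v : H), ‖U^[j] v‖ = ‖v‖ := fun j v => by
    induction j with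
    | zero => rfl
    | succ j ih => rw [Function.iterate_succ_apply', U.norm_map, ih]
  have hsum : ∀ (j R : ℕ) (v : ℕ → H), U^[j] (∑ i ∈ Finset.range R, v i)
      = ∑ i ∈ Finset.range R, U^[j] (v i) := fun j R v => by
    induction j with
    | zero => rfl
    | succ j ih => simp only [Function.iterate_succ_apply', ih, map_sum]
  have hsub : ∀ (j : ℕ) (v w : H), U^[j] (v - w) = U^[j] v - U^[j] w := fun j v w => by
    induction j with
    | zero => rfl
    | succ j ih => simp only [Function.iterate_succ_apply', ih, map_sub]
  have hone : ‖S - U S‖ ≤ 2 * ‖g‖ := by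
    have : S - U S = g - U^[M] g := by
      rw [hS, map_sum]
      simp only [← Function.iterate_succ_apply' (U : H → H)]
      rw [← Finset.sum_sub_distrib, Finset.sum_range_sub']
      rfl
    rw [this]
    calc ‖g - U^[M] g‖ ≤ ‖g‖ + ‖U^[M] g‖ := norm_sub_le _ _
      _ = 2 * ‖g‖ := by rw [hnorm]; ring
  have hj : ∀ j : ℕ, ‖S - U^[j] S‖ ≤ j * (2 * ‖g‖) := fun j => by
    induction j with
    | zero => simp
    | succ j ih =>
      have : S - U^[j + 1] S = (S - U^[j] S) + U^[j] (S - U S) := by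
        rw [hsub, Function.iterate_succ_apply]; abel
      rw [this]
      refine (norm_add_le _ _).trans ?_
      rw [hnorm]
      push_cast
      linarith
  have hswap : ∑ j ∈ Finset.range N, U^[j] S
      = ∑ i ∈ Finset.range M, U^[i] (∑ j ∈ Finset.range N, U^[j] g) := by
    simp only [hS, hsum]
    rw [Finset.sum_comm]
    simp only [← Function.iterate_add_apply, add_comm]
  have hdec : (N : ℝ) • S = ∑ j ∈ Finset.range N, (S - U^[j] S)
      + ∑ i ∈ Finset.range M, U^[i] (∑ j ∈ Finset.range N, U^[j] g) := by
    rw [← hswap, ← Finset.sum_add_distrib]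
    simp [Nat.cast_smul_eq_nsmul]
  have h1 : ‖∑ j ∈ Finset.range N, (S - U^[j] S)‖ ≤ 2 * N ^ 2 * ‖g‖ := by
    refine (norm_sum_le_of_le _ (f := fun j => S - U^[j] S) (n := fun _ => N * (2 * ‖g‖))
      fun j hjN => (hj j).trans ?_).trans ?_
    · have : (j : ℝ) ≤ N := by exact_mod_cast (Finset.mem_range.1 hjN).le
      gcongr
    · simp only [Finset.sum_const, Finset.card_range, nsmul_eq_mul]
      exact le_of_eq (by ring)
  have h2 : ‖∑ i ∈ Finset.range M, U^[i] (∑ j ∈ Finset.range N, U^[j] g)‖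
      ≤ M * ‖∑ j ∈ Finset.range N, U^[j] g‖ := by
    refine (norm_sum_le _ _).trans ?_
    simp [hnorm]
  calc N * ‖S‖ = ‖(N : ℝ) • S‖ := by rw [norm_smul]; simp
    _ ≤ _ := by rw [hdec]; refine (norm_add_le _ _).trans ?_; linarith

/-- Cesàro averages of the correlations of an isometry are small on all long intervals as soon as
they are small on one. -/
lemma sq_cesaro_inner_iterate_le {H : Type*} [NormedAddCommGroup H] [InnerProductSpace ℝ H]
    (U : H →ₗᵢ[ℝ] H) (g : H) {D : ℝ} (hD : ‖g‖ ^ 2 ≤ D) {N M : ℕ} (hN : 0 < N) (hM : 0 < M) :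
    ((∑ n ∈ Finset.range M, ⟪g, U^[n] g⟫_ℝ) / M) ^ 2 ≤
      2 * D / N ^ 2 * (∑ j ∈ Finset.range N,
        (2 * ∑ n ∈ Finset.range (j + 1), ⟪g, U^[n] g⟫_ℝ - ⟪g, U^[0] g⟫_ℝ))
      + 8 * D ^ 2 * (N / M) ^ 2 := by
  have h0 : ⟪g, U^[0] g⟫_ℝ = ‖g‖ ^ 2 := real_inner_self_eq_norm_sq g
  rw [h0, ← norm_sq_sum_iterate, ← inner_sum]
  have hkey := mul_norm_sum_iterate_le U g N M
  set S := ∑ i ∈ Finset.range M, U^[i] g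
  set R := ∑ i ∈ Finset.range N, U^[i] g
  have hN' : (0 : ℝ) < N := by exact_mod_cast hN
  have hM' : (0 : ℝ) < M := by exact_mod_cast hM
  have hD0 : 0 ≤ D := (sq_nonneg _).trans hD
  have hbd : ‖S‖ / M ≤ ‖R‖ / N + 2 * (N / M) * ‖g‖ := by
    have : ‖R‖ / N + 2 * (N / M) * ‖g‖ = (M * ‖R‖ + 2 * N ^ 2 * ‖g‖) / (N * M) := by
      field_simp
    rw [this, le_div_iff₀ (by positivity)]
    calc ‖S‖ / M * (N * M) = N * ‖S‖ := by field_simp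
      _ ≤ _ := hkey
  have hsq : (‖S‖ / M) ^ 2 ≤ 2 * (‖R‖ / N) ^ 2 + 8 * (N / M) ^ 2 * ‖g‖ ^ 2 := by
    have h1 : (‖S‖ / M) ^ 2 ≤ (‖R‖ / N + 2 * (N / M) * ‖g‖) ^ 2 := by gcongr
    nlinarith [sq_nonneg (‖R‖ / N - 2 * (N / M) * ‖g‖)]
  have hin : ⟪g, S⟫_ℝ ^ 2 ≤ ‖g‖ ^ 2 * ‖S‖ ^ 2 := by
    rw [← mul_pow]
    exact sq_le_sq' (neg_le_of_abs_le (abs_real_inner_le_norm g S)) (real_inner_le_norm g S)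
  calc (⟪g, S⟫_ℝ / M) ^ 2 = ⟪g, S⟫_ℝ ^ 2 / M ^ 2 := by rw [div_pow]
    _ ≤ ‖g‖ ^ 2 * ‖S‖ ^ 2 / M ^ 2 := by gcongr
    _ = ‖g‖ ^ 2 * (‖S‖ / M) ^ 2 := by rw [div_pow]; ring
    _ ≤ D * (2 * (‖R‖ / N) ^ 2 + 8 * (N / M) ^ 2 * D) := by
        have h2 : 8 * ((N : ℝ) / M) ^ 2 * ‖g‖ ^ 2 ≤ 8 * ((N : ℝ) / M) ^ 2 * D := by gcongr
        have h3 : (‖S‖ / M) ^ 2 ≤ 2 * (‖R‖ / N) ^ 2 + 8 * ((N : ℝ) / M) ^ 2 * D := by linarith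
        gcongr
    _ = _ := by rw [div_pow]; ring

/-- Averaging a family of sequences that satisfy the inequality of
`sq_cesaro_inner_iterate_le` gives a sequence for which smallness of one Cesàro average
controls all later ones. -/
lemma sq_cesaro_le_of_tendsto_cesaro {J : ℕ → ℕ → ℝ} {c : ℕ → ℝ} {D : ℝ} (hD : 0 ≤ D)
    (hJ : ∀ m N M : ℕ, 0 < N → 0 < M →
      ((∑ n ∈ Finset.range M, J m n) / M) ^ 2 ≤
        2 * D / N ^ 2 * (∑ j ∈ Finset.range N,
          (2 * ∑ n ∈ Finset.range (j + 1), J m n - J m 0)) + 8 * D ^ 2 * (N / M) ^ 2)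
    (hc : ∀ n, Tendsto (fun R : ℕ => (∑ m ∈ Finset.range R, J m n) / (R : ℝ)) atTop (nhds (c n)))
    (hc0 : ∀ n, 0 ≤ c n) {N M : ℕ} (hN : 0 < N) (hM : 0 < M) :
    ((∑ n ∈ Finset.range M, c n) / M) ^ 2 ≤
      4 * D * ((∑ n ∈ Finset.range N, c n) / N) + 8 * D ^ 2 * (N / M) ^ 2 := by
  have hlim : ((∑ n ∈ Finset.range M, c n) / M) ^ 2 ≤
      2 * D / N ^ 2 * (∑ j ∈ Finset.range N,
          (2 * ∑ n ∈ Finset.range (j + 1), c n - c 0)) + 8 * D ^ 2 * (N / M) ^ 2 := by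
    refine le_of_tendsto_of_tendsto
      (((tendsto_finsetSum (Finset.range M) fun n _ => hc n).div_const (M : ℝ)).pow 2)
      (((tendsto_finsetSum (Finset.range N) fun j _ =>
        ((tendsto_finsetSum (Finset.range (j + 1)) fun n _ => hc n).const_mul 2).sub
          (hc 0)).const_mul (2 * D / N ^ 2)).add_const _) ?_
    filter_upwards [eventually_gt_atTop 0] with R hR
    have hR' : (0 : ℝ) < R := by exact_mod_cast hR
    have hl : (∑ n ∈ Finset.range M, (∑ m ∈ Finset.range R, J m n) / (R : ℝ)) / M
        = (∑ m ∈ Finset.range R, (∑ n ∈ Finset.range M, J m n) / M) / R := by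
      rw [← Finset.sum_div, ← Finset.sum_div, Finset.sum_comm]; ring
    have hr : 2 * D / N ^ 2 * (∑ j ∈ Finset.range N,
          (2 * ∑ n ∈ Finset.range (j + 1), (∑ m ∈ Finset.range R, J m n) / (R : ℝ)
            - (∑ m ∈ Finset.range R, J m 0) / (R : ℝ))) + 8 * D ^ 2 * (N / M) ^ 2
        = (∑ m ∈ Finset.range R, (2 * D / N ^ 2 * (∑ j ∈ Finset.range N,
          (2 * ∑ n ∈ Finset.range (j + 1), J m n - J m 0)) + 8 * D ^ 2 * (N / M) ^ 2)) / R := by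
      have hswap : ∑ m ∈ Finset.range R, ∑ j ∈ Finset.range N,
            (2 * ∑ n ∈ Finset.range (j + 1), J m n - J m 0)
          = ∑ j ∈ Finset.range N, (2 * ∑ n ∈ Finset.range (j + 1), ∑ m ∈ Finset.range R, J m n
            - ∑ m ∈ Finset.range R, J m 0) := by
        rw [Finset.sum_comm]
        refine Finset.sum_congr rfl fun j _ => ?_
        rw [Finset.sum_sub_distrib, ← Finset.mul_sum]
        congr 2
        exact Finset.sum_comm
      rw [Finset.sum_add_distrib, ← Finset.mul_sum, hswap, add_div,
        mul_div_assoc (2 * D / (N : ℝ) ^ 2)]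
      congr 1
      · congr 1
        rw [Finset.sum_div (Finset.range N)]
        refine Finset.sum_congr rfl fun j _ => ?_
        rw [← Finset.sum_div]
        ring
      · simp only [Finset.sum_const, Finset.card_range, nsmul_eq_mul]
        field_simp
    rw [hl, hr]
    calc ((∑ m ∈ Finset.range R, (∑ n ∈ Finset.range M, J m n) / M) / R) ^ 2
        = (∑ m ∈ Finset.range R, (∑ n ∈ Finset.range M, J m n) / M) ^ 2 / R ^ 2 := div_pow _ _ _
      _ ≤ (R * ∑ m ∈ Finset.range R, ((∑ n ∈ Finset.range M, J m n) / M) ^ 2) / R ^ 2 := by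
          gcongr
          simpa using sq_sum_le_card_mul_sum_sq (s := Finset.range R)
            (f := fun m => (∑ n ∈ Finset.range M, J m n) / (M : ℝ))
      _ = (∑ m ∈ Finset.range R, ((∑ n ∈ Finset.range M, J m n) / M) ^ 2) / R := by
          field_simp
      _ ≤ _ := by
          gcongr with m hm
          exact hJ m N M hN hM
  have hN' : (0 : ℝ) < N := by exact_mod_cast hN
  have hsum : ∑ j ∈ Finset.range N, (2 * ∑ n ∈ Finset.range (j + 1), c n - c 0)
      ≤ N * (2 * ∑ n ∈ Finset.range N, c n) := by
    calc _ ≤ ∑ j ∈ Finset.range N, 2 * ∑ n ∈ Finset.range N, c n := by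
          refine Finset.sum_le_sum fun j hj => ?_
          have : ∑ n ∈ Finset.range (j + 1), c n ≤ ∑ n ∈ Finset.range N, c n :=
            Finset.sum_le_sum_of_subset_of_nonneg
              (Finset.range_mono (Finset.mem_range.1 hj)) fun n _ _ => hc0 n
          linarith [hc0 0]
      _ = _ := by simp
  calc _ ≤ _ := hlim
    _ ≤ 2 * D / N ^ 2 * (N * (2 * ∑ n ∈ Finset.range N, c n)) + 8 * D ^ 2 * (N / M) ^ 2 := by
        gcongr
    _ = _ := by
        congr 1
        field_simp
        ring

lemma memLp_of_abs_le {X : Type*} [MeasurableSpace X] {ν : Measure X} [IsFiniteMeasure ν]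
    {F : X → ℝ} (hF : Measurable F) {K : ℝ} (hK : ∀ x, |F x| ≤ K) (p : ENNReal) : MemLp F p ν :=
  MemLp.of_bound hF.aestronglyMeasurable K (ae_of_all _ hK)

lemma integrable_of_abs_le {X : Type*} [MeasurableSpace X] {ν : Measure X} [IsFiniteMeasure ν]
    {F : X → ℝ} (hF : Measurable F) {K : ℝ} (hK : ∀ x, |F x| ≤ K) : Integrable F ν :=
  memLp_one_iff_integrable.1 (memLp_of_abs_le hF hK 1)

lemma inner_toLp_toLp {X : Type*} [MeasurableSpace X] {ν : Measure X} {F G : X → ℝ}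
    (hF : MemLp F 2 ν) (hG : MemLp G 2 ν) :
    ⟪hF.toLp F, hG.toLp G⟫_ℝ = ∫ x, F x * G x ∂ν := by
  rw [L2.inner_def]
  refine integral_congr_ae ?_
  filter_upwards [hF.coeFn_toLp, hG.coeFn_toLp] with x hx hy
  simp [hx, hy, mul_comm]

lemma iterate_compMeasurePreserving_toLp {X : Type*} [MeasurableSpace X] {ν : Measure X}
    {T : X → X} (hT : MeasurePreserving T ν ν) {F : X → ℝ} (hF : MemLp F 2 ν) (n : ℕ) :
    (Lp.compMeasurePreservingₗᵢ ℝ T hT)^[n] (hF.toLp F)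
      = (hF.comp_measurePreserving (hT.iterate n)).toLp (F ∘ T^[n]) := by
  induction n with
  | zero => rfl
  | succ n ih =>
    rw [Function.iterate_succ_apply', ih]
    exact Lp.toLp_compMeasurePreserving _ hT

lemma exists_tendsto_cesaro_integral_mul_iterate {X : Type*} [MeasurableSpace X] {ν : Measure X}
    {T : X → X} (hT : MeasurePreserving T ν ν) {F : X → ℝ} (hF : MemLp F 2 ν) :
    ∃ c : ℝ, 0 ≤ c ∧
      Tendsto (fun M : ℕ => (∑ m ∈ Finset.range M, ∫ x, F x * F (T^[m] x) ∂ν) / (M : ℝ))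
        atTop (nhds c) ∧
      ∀ G : X → ℝ, MemLp G 2 ν → (∀ x, G (T x) = G x) →
        (∫ x, F x * G x ∂ν) ^ 2 ≤ c * ∫ x, G x * G x ∂ν := by
  obtain ⟨c, hc0, hc, hG⟩ :=
    exists_tendsto_cesaro_inner_iterate (Lp.compMeasurePreservingₗᵢ ℝ T hT) (hF.toLp F)
  refine ⟨c, hc0, ?_, fun G hG2 hGT => ?_⟩
  · simpa only [iterate_compMeasurePreserving_toLp hT hF, inner_toLp_toLp,
      Function.comp_apply] using hc
  · have hfix : Lp.compMeasurePreservingₗᵢ ℝ T hT (hG2.toLp G) = hG2.toLp G := by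
      have h1 := iterate_compMeasurePreserving_toLp hT hG2 1
      rw [Function.iterate_one] at h1
      rw [h1]
      exact MemLp.toLp_congr _ _ (ae_of_all _ hGT)
    have := hG _ hfix
    rwa [← real_inner_self_eq_norm_sq, inner_toLp_toLp, inner_toLp_toLp] at this

lemma sq_cesaro_integral_mul_iterate_le {X : Type*} [MeasurableSpace X] {ν : Measure X}
    [IsProbabilityMeasure ν] {T : X → X} (hT : MeasurePreserving T ν ν) {g : X → ℝ}
    (hg : Measurable g) {K : ℝ} (hK : ∀ x, |g x| ≤ K) {N M : ℕ} (hN : 0 < N) (hM : 0 < M) :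
    ((∑ n ∈ Finset.range M, ∫ x, g x * g (T^[n] x) ∂ν) / M) ^ 2 ≤
      2 * K ^ 2 / N ^ 2 * (∑ j ∈ Finset.range N,
        (2 * ∑ n ∈ Finset.range (j + 1), ∫ x, g x * g (T^[n] x) ∂ν
          - ∫ x, g x * g (T^[0] x) ∂ν))
      + 8 * (K ^ 2) ^ 2 * (N / M) ^ 2 := by
  have hg2 : MemLp g 2 ν := memLp_of_abs_le hg hK 2
  have hD : ‖hg2.toLp g‖ ^ 2 ≤ K ^ 2 := by
    rw [← real_inner_self_eq_norm_sq, inner_toLp_toLp]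
    have hle : ∀ x, g x * g x ≤ K ^ 2 := fun x => by
      rw [← sq, ← sq_abs]; exact pow_le_pow_left₀ (abs_nonneg _) (hK x) 2
    calc ∫ x, g x * g x ∂ν ≤ ∫ _, K ^ 2 ∂ν :=
          integral_mono_of_nonneg (ae_of_all _ fun x => mul_self_nonneg _)
            (integrable_const _) (ae_of_all _ hle)
      _ = K ^ 2 := by simp
  have := sq_cesaro_inner_iterate_le (Lp.compMeasurePreservingₗᵢ ℝ T hT) (hg2.toLp g) hD hN hM
  simpa only [iterate_compMeasurePreserving_toLp hT hg2, inner_toLp_toLp,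
    Function.comp_apply] using this

/-- The box correlation `∫ f · f∘T₁ᵐ · f∘T₂ⁿ · f∘(T₁ᵐT₂ⁿ) dν`. -/
noncomputable def boxCorr {X : Type*} [MeasurableSpace X] (ν : Measure X)
    (T₁ T₂ : X → X) (f : X → ℝ)
    (m n : ℕ) : ℝ :=
  ∫ x, f x * f (T₁^[m] x) * f (T₂^[n] x) * f (T₁^[m] (T₂^[n] x)) ∂ν

lemma measurable_boxIntegrand {X : Type*} [MeasurableSpace X] {T₁ T₂ : X → X}
    (hT₁ : Measurable T₁) (hT₂ : Measurable T₂) {f : X → ℝ} (hf : Measurable f) (m n : ℕ) :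
    Measurable fun x => f x * f (T₁^[m] x) * f (T₂^[n] x) * f (T₁^[m] (T₂^[n] x)) := by
  have h1 := hT₁.iterate m
  have h2 := hT₂.iterate n
  fun_prop

lemma abs_boxIntegrand_le {X : Type*} {T₁ T₂ : X → X} {f : X → ℝ} {K : ℝ} (hK : ∀ x, |f x| ≤ K)
    (m n : ℕ) (x : X) :
    |f x * f (T₁^[m] x) * f (T₂^[n] x) * f (T₁^[m] (T₂^[n] x))| ≤ K ^ 4 := by
  have hK0 : 0 ≤ K := (abs_nonneg _).trans (hK x)
  calc _ = |f x| * |f (T₁^[m] x)| * |f (T₂^[n] x)| * |f (T₁^[m] (T₂^[n] x))| := by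
        simp only [abs_mul]
    _ ≤ K * K * K * K := by gcongr <;> exact hK _
    _ = K ^ 4 := by ring

lemma abs_boxCorr_le {X : Type*} [MeasurableSpace X] {ν : Measure X} [IsProbabilityMeasure ν]
    {T₁ T₂ : X → X} {f : X → ℝ} {K : ℝ} (hK : ∀ x, |f x| ≤ K) (m n : ℕ) :
    |boxCorr ν T₁ T₂ f m n| ≤ K ^ 4 := by
  have := norm_integral_le_of_norm_le_const (μ := ν)
    (f := fun x => f x * f (T₁^[m] x) * f (T₂^[n] x) * f (T₁^[m] (T₂^[n] x)))
    (ae_of_all _ (abs_boxIntegrand_le (T₁ := T₁) (T₂ := T₂) hK m n))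
  simpa [boxCorr] using this

/-- For an invariant measure, the inner limits of the box average exist, are nonnegative,
satisfy the inequality of `sq_cesaro_le_of_tendsto_cesaro`, and control the inner products of
`f · f∘T₂ⁿ` with `T₁`-invariant functions. -/
lemma exists_boxCorr_limit {X : Type*} [MeasurableSpace X] {ν : Measure X}
    [IsProbabilityMeasure ν] {T₁ T₂ : X → X} (h₁ : MeasurePreserving T₁ ν ν)
    (h₂ : MeasurePreserving T₂ ν ν) (hcomm : Function.Commute T₁ T₂)
    {f : X → ℝ} (hf : Measurable f) {K : ℝ} (hK : ∀ x, |f x| ≤ K) :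
    ∃ c : ℕ → ℝ, (∀ n, 0 ≤ c n) ∧
      (∀ n, Tendsto (fun M : ℕ => (∑ m ∈ Finset.range M, boxCorr ν T₁ T₂ f m n) / (M : ℝ))
        atTop (nhds (c n))) ∧
      (∀ n, ∀ G : X → ℝ, MemLp G 2 ν → (∀ x, G (T₁ x) = G x) →
        (∫ x, f x * f (T₂^[n] x) * G x ∂ν) ^ 2 ≤ c n * ∫ x, G x * G x ∂ν) ∧
      ∀ N M : ℕ, 0 < N → 0 < M → ((∑ n ∈ Finset.range M, c n) / M) ^ 2 ≤
        4 * (K ^ 2) ^ 2 * ((∑ n ∈ Finset.range N, c n) / N)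
          + 8 * ((K ^ 2) ^ 2) ^ 2 * (N / M) ^ 2 := by
  have hprod : ∀ S : X → X, Measurable S → Measurable (fun x => f x * f (S x)) ∧
      ∀ x, |f x * f (S x)| ≤ K ^ 2 := fun S hS => by
    refine ⟨by fun_prop, fun x => ?_⟩
    rw [abs_mul, sq]
    exact mul_le_mul (hK _) (hK _) (abs_nonneg _) ((abs_nonneg _).trans (hK x))
  have hF : ∀ n, MemLp (fun x => f x * f (T₂^[n] x)) 2 ν := fun n =>
    memLp_of_abs_le (hprod _ (h₂.measurable.iterate n)).1 (hprod _ (h₂.measurable.iterate n)).2 2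
  choose c hc0 hc hG using fun n => exists_tendsto_cesaro_integral_mul_iterate h₁ (hF n)
  have hlim : ∀ n, Tendsto (fun M : ℕ =>
      (∑ m ∈ Finset.range M, boxCorr ν T₁ T₂ f m n) / (M : ℝ)) atTop (nhds (c n)) := fun n => by
    refine (hc n).congr fun M => ?_
    congr 1
    refine Finset.sum_congr rfl fun m _ => integral_congr_ae (ae_of_all _ fun x => ?_)
    have : T₂^[n] (T₁^[m] x) = T₁^[m] (T₂^[n] x) := ((hcomm.iterate_iterate m n) x).symm
    simp only [this]
    ring
  refine ⟨c, hc0, hlim, hG, fun N M hN hM =>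
    sq_cesaro_le_of_tendsto_cesaro (by positivity) (fun m N M hN hM => ?_) hlim hc0 hN hM⟩
  have hg := hprod _ (h₁.measurable.iterate m)
  have := sq_cesaro_integral_mul_iterate_le h₂ hg.1 hg.2 hN hM
  simpa only [boxCorr, mul_assoc] using this

lemma hasBoxAvg_zero_of_tendsto {X : Type*} [MeasurableSpace X] {ν : Measure X}
    {T₁ T₂ : X → X} {f : X → ℝ} {c : ℕ → ℝ}
    (hc : ∀ n, Tendsto (fun M : ℕ => (∑ m ∈ Finset.range M, boxCorr ν T₁ T₂ f m n) / (M : ℝ))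
        atTop (nhds (c n)))
    (hlim : Tendsto (fun N : ℕ => (∑ n ∈ Finset.range N, c n) / (N : ℝ)) atTop (nhds 0)) :
    HasBoxAvg ν T₁ T₂ f 0 :=
  ⟨c, hc, hlim⟩

lemma HasBoxAvg.tendsto_of_tendsto {X : Type*} [MeasurableSpace X] {ν : Measure X}
    {T₁ T₂ : X → X} {f : X → ℝ} {L : ℝ} {c : ℕ → ℝ} (h : HasBoxAvg ν T₁ T₂ f L)
    (hc : ∀ n, Tendsto (fun M : ℕ => (∑ m ∈ Finset.range M, boxCorr ν T₁ T₂ f m n) / (M : ℝ))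
        atTop (nhds (c n))) :
    Tendsto (fun N : ℕ => (∑ n ∈ Finset.range N, c n) / (N : ℝ)) atTop (nhds L) := by
  obtain ⟨d, hd, hL⟩ := h
  have : d = c := funext fun n => tendsto_nhds_unique (hd n) (hc n)
  exact this ▸ hL

lemma invSigma_le {X : Type*} [m : MeasurableSpace X] (T : X → X) : invSigma T ≤ m :=
  fun _ hs => hs.1

lemma invSigma_sup_le {X : Type*} [m : MeasurableSpace X] (T₁ T₂ : X → X) :
    invSigma T₁ ⊔ invSigma T₂ ≤ m :=
  sup_le (invSigma_le T₁) (invSigma_le T₂)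

lemma integral_mul_mul_eq_zero_of_hasBoxAvg_zero {X : Type*} [MeasurableSpace X] {ν : Measure X}
    [IsProbabilityMeasure ν] {T₁ T₂ : X → X} (h₁ : MeasurePreserving T₁ ν ν)
    (h₂ : MeasurePreserving T₂ ν ν) (hcomm : Function.Commute T₁ T₂)
    {f : X → ℝ} (hf : Measurable f) {K : ℝ} (hK : ∀ x, |f x| ≤ K)
    (hbox : HasBoxAvg ν T₁ T₂ f 0) {g₁ g₂ : X → ℝ} (hg₁ : Measurable g₁) (hg₂ : Measurable g₂)
    (hb₁ : ∀ x, |g₁ x| ≤ 1) (hb₂ : ∀ x, |g₂ x| ≤ 1) (hi₁ : ∀ x, g₁ (T₁ x) = g₁ x)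
    (hi₂ : ∀ x, g₂ (T₂ x) = g₂ x) :
    ∫ x, f x * g₁ x * g₂ x ∂ν = 0 := by
  obtain ⟨c, hc0, hc, hG, -⟩ := exists_boxCorr_limit h₁ h₂ hcomm hf hK
  have hlim := hbox.tendsto_of_tendsto hc
  have hF : MemLp (fun x => f x * g₁ x) 2 ν := memLp_of_abs_le (by fun_prop) (K := K * 1)
    (fun x => by
      rw [abs_mul]
      exact mul_le_mul (hK x) (hb₁ x) (abs_nonneg _) ((abs_nonneg _).trans (hK x))) 2
  obtain ⟨d, hd0, hd, hdG⟩ := exists_tendsto_cesaro_integral_mul_iterate h₂ hF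
  have hterm : ∀ n, (∫ x, f x * g₁ x * (f (T₂^[n] x) * g₁ (T₂^[n] x)) ∂ν) ^ 2 ≤ c n := fun n => by
    have hbG : ∀ x, |g₁ x * g₁ (T₂^[n] x)| ≤ 1 := fun x => by
      rw [abs_mul]; exact mul_le_one₀ (hb₁ _) (abs_nonneg _) (hb₁ _)
    have hmG : Measurable fun x => g₁ x * g₁ (T₂^[n] x) :=
      hg₁.mul (hg₁.comp (h₂.measurable.iterate n))
    have := hG n (fun x => g₁ x * g₁ (T₂^[n] x)) (memLp_of_abs_le hmG hbG 2) fun x => by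
      have hx : T₂^[n] (T₁ x) = T₁ (T₂^[n] x) := ((hcomm.iterate_right n) x).symm
      simp only [hx, hi₁]
    have hle : ∫ x, (g₁ x * g₁ (T₂^[n] x)) * (g₁ x * g₁ (T₂^[n] x)) ∂ν ≤ 1 := by
      calc _ ≤ ∫ _, (1 : ℝ) ∂ν := integral_mono_of_nonneg (ae_of_all _ fun x => mul_self_nonneg _)
            (integrable_const _) (ae_of_all _ fun x => by
              simpa [sq] using (sq_le_one_iff_abs_le_one _).2 (hbG x))
        _ = 1 := by simp
    have heq : ∫ x, f x * g₁ x * (f (T₂^[n] x) * g₁ (T₂^[n] x)) ∂ν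
        = ∫ x, f x * f (T₂^[n] x) * (g₁ x * g₁ (T₂^[n] x)) ∂ν :=
      integral_congr_ae (ae_of_all _ fun x => by ring)
    rw [heq]
    exact this.trans (mul_le_of_le_one_right (hc0 n) hle)
  have hd2 : d ^ 2 ≤ 0 := by
    refine le_of_tendsto_of_tendsto (hd.pow 2) hlim ?_
    filter_upwards [eventually_gt_atTop 0] with M hM
    have hM' : (0 : ℝ) < M := by exact_mod_cast hM
    calc _ = (∑ n ∈ Finset.range M,
          ∫ x, f x * g₁ x * (f (T₂^[n] x) * g₁ (T₂^[n] x)) ∂ν) ^ 2 / M ^ 2 := div_pow _ _ _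
      _ ≤ (M * ∑ n ∈ Finset.range M, c n) / M ^ 2 := by
          gcongr
          refine sq_sum_le_card_mul_sum_sq.trans ?_
          rw [Finset.card_range]
          gcongr with n hn
          exact hterm n
      _ = _ := by field_simp
  have hd' : d = 0 := by nlinarith [sq_nonneg d]
  have := hdG g₂ (memLp_of_abs_le hg₂ hb₂ 2) hi₂
  rw [hd', zero_mul] at this
  exact pow_eq_zero_iff two_ne_zero |>.1 (le_antisymm this (sq_nonneg _))

lemma sup_eq_generateFrom_inter {X : Type*} (m₁ m₂ : MeasurableSpace X) :
    m₁ ⊔ m₂ = MeasurableSpace.generateFrom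
      {s | ∃ A B, MeasurableSet[m₁] A ∧ MeasurableSet[m₂] B ∧ A ∩ B = s} := by
  refine le_antisymm (sup_le (fun A hA => ?_) fun B hB => ?_)
    (MeasurableSpace.generateFrom_le ?_)
  · exact MeasurableSpace.measurableSet_generateFrom
      ⟨A, Set.univ, hA, MeasurableSet.univ, Set.inter_univ A⟩
  · exact MeasurableSpace.measurableSet_generateFrom
      ⟨Set.univ, B, MeasurableSet.univ, hB, Set.univ_inter B⟩
  · rintro _ ⟨A, B, hA, hB, rfl⟩
    have hA' : MeasurableSet[m₁ ⊔ m₂] A := (le_sup_left : m₁ ≤ m₁ ⊔ m₂) A hA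
    have hB' : MeasurableSet[m₁ ⊔ m₂] B := (le_sup_right : m₂ ≤ m₁ ⊔ m₂) B hB
    exact hA'.inter hB'

/-- A function with vanishing box average is orthogonal to `ℐ(T₁) ∨ ℐ(T₂)`. -/
lemma HasBoxAvg.condExp_ae_eq_zero {X : Type*} [mX : MeasurableSpace X] {ν : Measure X}
    [IsProbabilityMeasure ν] {T₁ T₂ : X → X} (h₁ : MeasurePreserving T₁ ν ν)
    (h₂ : MeasurePreserving T₂ ν ν) (hcomm : Function.Commute T₁ T₂)
    {f : X → ℝ} (hf : Measurable f) {K : ℝ} (hK : ∀ x, |f x| ≤ K)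
    (hbox : HasBoxAvg ν T₁ T₂ f 0) :
    ν[f | invSigma T₁ ⊔ invSigma T₂] =ᵐ[ν] 0 := by
  have hm := invSigma_sup_le T₁ T₂
  have hfi : Integrable f ν := integrable_of_abs_le hf hK
  have hrect : ∀ A B, MeasurableSet[invSigma T₁] A → MeasurableSet[invSigma T₂] B →
      ∫ x in A ∩ B, f x ∂ν = 0 := fun A B hA hB => by
    have hb : ∀ (S : Set X) (x : X), |S.indicator (fun _ => (1 : ℝ)) x| ≤ 1 := fun S x => by
      by_cases hx : x ∈ S <;> simp [hx]
    have hi : ∀ (T : X → X) (S : Set X), T ⁻¹' S = S → ∀ x,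
        S.indicator (fun _ => (1 : ℝ)) (T x) = S.indicator (fun _ => (1 : ℝ)) x :=
      fun T S hS x => by
        have : T x ∈ S ↔ x ∈ S := by rw [← Set.mem_preimage, hS]
        by_cases hx : x ∈ S <;> simp [hx, this]
    rw [← integral_indicator (hA.1.inter hB.1),
      ← integral_mul_mul_eq_zero_of_hasBoxAvg_zero h₁ h₂ hcomm hf hK hbox
        (measurable_const.indicator hA.1) (measurable_const.indicator hB.1) (hb A) (hb B)
        (hi T₁ A hA.2) (hi T₂ B hB.2)]
    refine integral_congr_ae (ae_of_all _ fun x => ?_)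
    by_cases hxA : x ∈ A <;> by_cases hxB : x ∈ B <;> simp [hxA, hxB]
  have hall : ∀ s, MeasurableSet[invSigma T₁ ⊔ invSigma T₂] s → ∫ x in s, f x ∂ν = 0 := by
    refine MeasurableSpace.induction_on_inter (sup_eq_generateFrom_inter _ _) ?_ ?_ ?_ ?_ ?_
    · rintro _ ⟨A, B, hA, hB, rfl⟩ _ ⟨A', B', hA', hB', rfl⟩ -
      exact ⟨A ∩ A', B ∩ B', MeasurableSet.inter hA hA', MeasurableSet.inter hB hB',
        Set.inter_inter_inter_comm _ _ _ _⟩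
    · simp
    · rintro _ ⟨A, B, hA, hB, rfl⟩
      exact hrect A B hA hB
    · intro t ht h
      have huniv : ∫ x, f x ∂ν = 0 := by
        have := hrect Set.univ Set.univ MeasurableSet.univ MeasurableSet.univ
        simpa using this
      have := integral_add_compl (hm t ht) hfi
      linarith
    · intro s hd hs h
      rw [integral_iUnion (fun i => hm _ (hs i)) hd hfi.integrableOn]
      simp [h]
  refine (ae_eq_condExp_of_forall_setIntegral_eq hm hfi (fun s _ _ => ?_) (fun s hs _ => ?_)
    ?_).symm
  · exact integrableOn_zero
  · rw [hall s hs]; simp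
  · exact aestronglyMeasurable_zero

lemma abs_mul_four_sub_le {a b c d a' b' c' d' K : ℝ} (hb : |b| ≤ K) (hc : |c| ≤ K)
    (hd : |d| ≤ K) (ha' : |a'| ≤ K) (hb' : |b'| ≤ K) (hc' : |c'| ≤ K) :
    |a * b * c * d - a' * b' * c' * d'|
      ≤ K ^ 3 * (|a - a'| + |b - b'| + |c - c'| + |d - d'|) := by
  have hK0 : 0 ≤ K := (abs_nonneg _).trans hb
  have h3 : ∀ {x y z : ℝ} (w : ℝ), |x| ≤ K → |y| ≤ K → |z| ≤ K →
      |w * (x * y * z)| ≤ K ^ 3 * |w| := fun {x y z} w hx hy hz => by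
    rw [abs_mul, abs_mul, abs_mul, mul_comm]
    have : |x| * |y| * |z| ≤ K * K * K := by gcongr
    calc _ ≤ K * K * K * |w| := by gcongr
      _ = _ := by ring
  have hsplit : a * b * c * d - a' * b' * c' * d' = (a - a') * (b * c * d)
      + (b - b') * (a' * c * d) + (c - c') * (a' * b' * d) + (d - d') * (a' * b' * c') := by ring
  rw [hsplit]
  refine (abs_add_le _ _).trans ?_
  have e1 := (abs_add_le ((a - a') * (b * c * d) + (b - b') * (a' * c * d))
    ((c - c') * (a' * b' * d)))
  have e2 := abs_add_le ((a - a') * (b * c * d)) ((b - b') * (a' * c * d))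
  linarith [h3 (a - a') hb hc hd, h3 (b - b') ha' hc hd, h3 (c - c') ha' hb' hd,
    h3 (d - d') ha' hb' hc']

lemma abs_boxCorr_sub_le {X : Type*} [MeasurableSpace X] {ν : Measure X}
    [IsProbabilityMeasure ν] {T₁ T₂ : X → X} (h₁ : MeasurePreserving T₁ ν ν)
    (h₂ : MeasurePreserving T₂ ν ν) {f h : X → ℝ} (hf : Measurable f) (hh : Measurable h) {K : ℝ}
    (hfK : ∀ x, |f x| ≤ K) (hhK : ∀ x, |h x| ≤ K) (m n : ℕ) :
    |boxCorr ν T₁ T₂ f m n - boxCorr ν T₁ T₂ h m n| ≤ 4 * K ^ 3 * ∫ x, |f x - h x| ∂ν := by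
  have hint : Integrable (fun x => |f x - h x|) ν :=
    ((integrable_of_abs_le hf hfK).sub (integrable_of_abs_le hh hhK)).abs
  have hcomp : ∀ {S : X → X}, MeasurePreserving S ν ν →
      Integrable (fun x => |f (S x) - h (S x)|) ν ∧
        ∫ x, |f (S x) - h (S x)| ∂ν = ∫ x, |f x - h x| ∂ν := fun {S} hS => by
    refine ⟨hS.integrable_comp_of_integrable hint, ?_⟩
    have hmeas : Measurable fun x => |f x - h x| := (hf.sub hh).abs
    have := integral_map (μ := ν) hS.aemeasurable (f := fun x => |f x - h x|)
      hmeas.aestronglyMeasurable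
    rw [hS.map_eq] at this
    exact this.symm
  obtain ⟨i1, e1⟩ := hcomp (h₁.iterate m)
  obtain ⟨i2, e2⟩ := hcomp (h₂.iterate n)
  obtain ⟨i3, e3⟩ := hcomp ((h₁.iterate m).comp (h₂.iterate n))
  simp only [Function.comp_apply] at i3 e3
  have i12 : Integrable (fun x => |f x - h x| + |f (T₁^[m] x) - h (T₁^[m] x)|) ν := hint.add i1
  have i123 : Integrable (fun x => |f x - h x| + |f (T₁^[m] x) - h (T₁^[m] x)|
      + |f (T₂^[n] x) - h (T₂^[n] x)|) ν := i12.add i2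
  have hbox : ∀ {u : X → ℝ}, Measurable u → (∀ x, |u x| ≤ K) →
      Integrable (fun x => u x * u (T₁^[m] x) * u (T₂^[n] x) * u (T₁^[m] (T₂^[n] x))) ν :=
    fun hu huK => integrable_of_abs_le
      (measurable_boxIntegrand h₁.measurable h₂.measurable hu m n) (abs_boxIntegrand_le huK m n)
  rw [boxCorr, boxCorr, ← integral_sub (hbox hf hfK) (hbox hh hhK)]
  refine (abs_integral_le_integral_abs).trans ?_
  calc _ ≤ ∫ x, K ^ 3 * (|f x - h x| + |f (T₁^[m] x) - h (T₁^[m] x)|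
        + |f (T₂^[n] x) - h (T₂^[n] x)|
        + |f (T₁^[m] (T₂^[n] x)) - h (T₁^[m] (T₂^[n] x))|) ∂ν :=
        integral_mono (((hbox hf hfK).sub (hbox hh hhK)).abs)
          ((i123.add i3).const_mul _)
          fun x => abs_mul_four_sub_le (hfK _) (hfK _) (hfK _) (hhK _) (hhK _) (hhK _)
    _ = _ := by
        rw [integral_const_mul, integral_add i123 i3, integral_add i12 i2,
          integral_add hint i1, e1, e2, e3]
        ring

/-- Vanishing of the box average passes to `L¹`-limits of uniformly bounded functions. -/
lemma hasBoxAvg_zero_of_approx {X : Type*} [MeasurableSpace X] {ν : Measure X}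
    [IsProbabilityMeasure ν] {T₁ T₂ : X → X} (h₁ : MeasurePreserving T₁ ν ν)
    (h₂ : MeasurePreserving T₂ ν ν) (hcomm : Function.Commute T₁ T₂)
    {f : X → ℝ} (hf : Measurable f) {K : ℝ} (hK : ∀ x, |f x| ≤ K)
    (happ : ∀ ε > 0, ∃ h : X → ℝ, Measurable h ∧ (∀ x, |h x| ≤ K) ∧ HasBoxAvg ν T₁ T₂ h 0 ∧
      ∫ x, |f x - h x| ∂ν ≤ ε) :
    HasBoxAvg ν T₁ T₂ f 0 := by
  obtain ⟨x₀⟩ : Nonempty X := nonempty_of_isProbabilityMeasure ν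
  have hK0 : 0 ≤ K := (abs_nonneg _).trans (hK x₀)
  obtain ⟨c, hc0, hc, -, -⟩ := exists_boxCorr_limit h₁ h₂ hcomm hf hK
  refine hasBoxAvg_zero_of_tendsto hc ?_
  rw [Metric.tendsto_atTop]
  intro ε hε
  obtain ⟨h, hh, hhK, hbox, hclose⟩ := happ (ε / (2 * (4 * K ^ 3 + 1))) (by positivity)
  obtain ⟨d, -, hd, -, -⟩ := exists_boxCorr_limit h₁ h₂ hcomm hh hhK
  have hsmall : 4 * K ^ 3 * ∫ x, |f x - h x| ∂ν ≤ ε / 2 := by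
    calc _ ≤ (4 * K ^ 3 + 1) * (ε / (2 * (4 * K ^ 3 + 1))) := by
          exact mul_le_mul (by linarith) hclose (integral_nonneg fun x => abs_nonneg _)
            (by positivity)
      _ = ε / 2 := by field_simp
  have hcd : ∀ n, c n ≤ d n + ε / 2 := fun n => by
    refine le_of_tendsto_of_tendsto (hc n) ((hd n).add_const _) ?_
    filter_upwards [eventually_gt_atTop 0] with M hM
    have hM' : (0 : ℝ) < M := by exact_mod_cast hM
    calc _ ≤ (∑ m ∈ Finset.range M, (boxCorr ν T₁ T₂ h m n + ε / 2)) / (M : ℝ) := by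
          gcongr with m hm
          linarith [le_of_abs_le (abs_boxCorr_sub_le h₁ h₂ hf hh hK hhK m n)]
      _ = _ := by
          simp only [Finset.sum_add_distrib, Finset.sum_const, Finset.card_range, nsmul_eq_mul]
          field_simp
  obtain ⟨N₀, hN₀⟩ := Metric.tendsto_atTop.1 (hbox.tendsto_of_tendsto hd) (ε / 2) (by positivity)
  refine ⟨N₀ + 1, fun N hN => ?_⟩
  have hN' : (0 : ℝ) < N := by exact_mod_cast (by omega : 0 < N)
  have hdN := lt_of_abs_lt (by simpa only [Real.dist_eq, sub_zero] using hN₀ N (by omega) :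
    |(∑ n ∈ Finset.range N, d n) / (N : ℝ)| < ε / 2)
  rw [Real.dist_eq, sub_zero,
    abs_of_nonneg (div_nonneg (Finset.sum_nonneg fun n _ => hc0 n) hN'.le)]
  calc _ ≤ (∑ n ∈ Finset.range N, (d n + ε / 2)) / (N : ℝ) := by
        gcongr with n hn
        exact hcd n
    _ = (∑ n ∈ Finset.range N, d n) / (N : ℝ) + ε / 2 := by
        simp only [Finset.sum_add_distrib, Finset.sum_const, Finset.card_range, nsmul_eq_mul]
        field_simp
    _ < ε := by linarith

/-- A sequence of nonnegative numbers for which smallness of one term forces smallness of all much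
later terms converges to `0` as soon as a subsequence does. -/
lemma tendsto_zero_of_subseq {C : ℕ → ℝ} {a b : ℝ}
    (hC : ∀ N M : ℕ, 0 < N → 0 < M → C M ^ 2 ≤ a * C N + b * (N / M) ^ 2)
    {ns : ℕ → ℕ} (hns : StrictMono ns) (hlim : Tendsto (fun i => C (ns i)) atTop (nhds 0)) :
    Tendsto C atTop (nhds 0) := by
  suffices hsq : Tendsto (fun M => C M ^ 2) atTop (nhds 0) by
    have h := hsq.sqrt
    simp only [Real.sqrt_sq_eq_abs, Real.sqrt_zero] at h
    exact (tendsto_zero_iff_abs_tendsto_zero _).2 h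
  rw [Metric.tendsto_atTop]
  intro ε hε
  have h1 : Tendsto (fun i => a * C (ns i)) atTop (nhds 0) := by simpa using hlim.const_mul a
  obtain ⟨i, hi, hpos⟩ := ((h1.eventually (gt_mem_nhds (half_pos hε))).and
    (hns.tendsto_atTop.eventually (eventually_gt_atTop 0))).exists
  have h2 : Tendsto (fun M : ℕ => b * ((ns i : ℝ) / M) ^ 2) atTop (nhds 0) := by
    simpa using ((tendsto_const_div_atTop_nhds_zero_nat (ns i : ℝ)).pow 2).const_mul b
  obtain ⟨M₀, hM₀⟩ := eventually_atTop.1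
    ((h2.eventually (gt_mem_nhds (half_pos hε))).and (eventually_gt_atTop 0))
  refine ⟨M₀, fun M hM => ?_⟩
  rw [Real.dist_eq, sub_zero, abs_of_nonneg (sq_nonneg _)]
  linarith [hC (ns i) M hpos (hM₀ M hM).2, (hM₀ M hM).1]

/-- If `f` has box average `0` under `μ`, then it has box average `0` under almost every component
of an invariant disintegration of `μ`. -/
lemma HasBoxAvg.ae_of_disintegration {X : Type*} {m : MeasurableSpace X}
    [mX : MeasurableSpace X] {μ : Measure X} [IsProbabilityMeasure μ] {T₁ T₂ : X → X}
    (h₁ : MeasurePreserving T₁ μ μ) (h₂ : MeasurePreserving T₂ μ μ)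
    (hcomm : Function.Commute T₁ T₂) (hm : m ≤ mX) {μx : X → Measure X}
    (hprob : ∀ x, IsProbabilityMeasure (μx x))
    (hinv₁ : ∀ x, MeasurePreserving T₁ (μx x) (μx x))
    (hinv₂ : ∀ x, MeasurePreserving T₂ (μx x) (μx x))
    (hdecomp : ∀ g : X → ℝ, Measurable g → (∃ C : ℝ, ∀ x, |g x| ≤ C) →
      ∀ᵐ x ∂μ, (μ[g | m]) x = ∫ y, g y ∂(μx x))
    {f : X → ℝ} (hf : Measurable f) {K : ℝ} (hK : ∀ x, |f x| ≤ K)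
    (hbox : HasBoxAvg μ T₁ T₂ f 0) :
    ∀ᵐ x ∂μ, HasBoxAvg (μx x) T₁ T₂ f 0 := by
  obtain ⟨c, -, hc, -, -⟩ := exists_boxCorr_limit h₁ h₂ hcomm hf hK
  choose d hd0 hd _ hdC using fun x =>
    exists_boxCorr_limit (hinv₁ x) (hinv₂ x) hcomm hf hK
  have hJ : ∀ k n, μ[fun x => f x * f (T₁^[k] x) * f (T₂^[n] x) * f (T₁^[k] (T₂^[n] x)) | m]
      =ᵐ[μ] fun x => boxCorr (μx x) T₁ T₂ f k n := fun k n =>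
    hdecomp _ (measurable_boxIntegrand h₁.measurable h₂.measurable hf k n)
      ⟨K ^ 4, abs_boxIntegrand_le hK k n⟩
  have hJm : ∀ k n, AEStronglyMeasurable (fun x => boxCorr (μx x) T₁ T₂ f k n) μ := fun k n =>
    (stronglyMeasurable_condExp.mono hm).aestronglyMeasurable.congr (hJ k n)
  have hJint : ∀ k n, ∫ x, boxCorr (μx x) T₁ T₂ f k n ∂μ = boxCorr μ T₁ T₂ f k n := fun k n => by
    rw [← integral_congr_ae (hJ k n), integral_condExp hm, boxCorr]
  have hJi : ∀ k n, Integrable (fun x => boxCorr (μx x) T₁ T₂ f k n) μ := fun k n =>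
    Integrable.of_bound (hJm k n) (K ^ 4) (ae_of_all _ fun x => abs_boxCorr_le hK k n)
  have havg_m : ∀ n (M : ℕ), AEStronglyMeasurable
      (fun x => (∑ k ∈ Finset.range M, boxCorr (μx x) T₁ T₂ f k n) / (M : ℝ)) μ := fun n M =>
    ((integrable_finsetSum _ fun k _ => hJi k n).div_const _).aestronglyMeasurable
  have havg_le : ∀ n (M : ℕ) x,
      ‖(∑ k ∈ Finset.range M, boxCorr (μx x) T₁ T₂ f k n) / (M : ℝ)‖ ≤ K ^ 4 := fun n M x => by
    rw [norm_div, Real.norm_natCast]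
    refine div_le_of_le_mul₀ (Nat.cast_nonneg _) (by positivity) ?_
    refine (norm_sum_le_of_le _ fun k _ => abs_boxCorr_le hK k n).trans (le_of_eq ?_)
    simp [mul_comm]
  have hdm : ∀ n, AEStronglyMeasurable (fun x => d x n) μ := fun n =>
    aestronglyMeasurable_of_tendsto_ae atTop (havg_m n) (ae_of_all _ fun x => hd x n)
  have hd_le : ∀ n x, ‖d x n‖ ≤ K ^ 4 := fun n x =>
    le_of_tendsto (hd x n).norm (Eventually.of_forall fun M => havg_le n M x)
  have hdi : ∀ n, Integrable (fun x => d x n) μ := fun n =>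
    Integrable.of_bound (hdm n) (K ^ 4) (ae_of_all _ (hd_le n))
  have hdint : ∀ n, ∫ x, d x n ∂μ = c n := fun n => by
    refine tendsto_nhds_unique (tendsto_integral_of_dominated_convergence (fun _ => K ^ 4)
      (havg_m n) (integrable_const _) (fun M => ae_of_all _ (havg_le n M))
      (ae_of_all _ fun x => hd x n)) ((hc n).congr fun M => ?_)
    rw [integral_div, integral_finsetSum _ fun k _ => hJi k n]
    simp only [hJint]
  let C : ℕ → X → ℝ := fun N x => (∑ n ∈ Finset.range N, d x n) / (N : ℝ)
  have hC0 : ∀ N x, 0 ≤ C N x := fun N x =>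
    div_nonneg (Finset.sum_nonneg fun n _ => hd0 x n) (Nat.cast_nonneg _)
  have hCi : ∀ N, Integrable (C N) μ := fun N =>
    (integrable_finsetSum _ fun n _ => hdi n).div_const _
  have hCint : Tendsto (fun N => ∫ x, C N x ∂μ) atTop (nhds 0) := by
    refine (hbox.tendsto_of_tendsto hc).congr fun N => ?_
    rw [integral_div, integral_finsetSum _ fun n _ => hdi n]
    simp only [hdint]
  have hmeas : TendstoInMeasure μ C atTop 0 := by
    refine tendstoInMeasure_of_tendsto_eLpNorm one_ne_zero
      (fun N => (hCi N).aestronglyMeasurable) aestronglyMeasurable_zero ?_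
    have h := (ENNReal.continuous_ofReal.tendsto 0).comp hCint
    rw [ENNReal.ofReal_zero] at h
    refine h.congr fun N => ?_
    rw [sub_zero, eLpNorm_one_eq_lintegral_enorm,
      ← ofReal_integral_norm_eq_lintegral_enorm (hCi N)]
    simp only [Function.comp_apply, Real.norm_of_nonneg (hC0 N _)]
  obtain ⟨ns, hns, hae⟩ := hmeas.exists_seq_tendsto_ae
  filter_upwards [hae] with x hx
  exact hasBoxAvg_zero_of_tendsto (hd x) (tendsto_zero_of_subseq (hdC x) hns hx)

/-- On a standard Borel space there is a sequence of measurable functions that is dense in the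
bounded functions for the `L¹`-norm of every probability measure. -/
lemma exists_seq_dense_L1 (X : Type*) [MeasurableSpace X] [StandardBorelSpace X] :
    ∃ q : ℕ → X → ℝ, (∀ k, Measurable (q k)) ∧
      ∀ (ν : Measure X) [IsProbabilityMeasure ν] (f : X → ℝ), Measurable f →
        (∃ C : ℝ, ∀ x, |f x| ≤ C) → ∀ ε > 0, ∃ k,
          Integrable (q k) ν ∧ ∫ x, |f x - q k x| ∂ν ≤ ε := by
  let e : X → ℕ → Bool := MeasurableSpace.mapNatBool X
  have hem : Measurable e := MeasurableSpace.measurable_mapNatBool X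
  have he : MeasurableEmbedding e :=
    hem.measurableEmbedding (MeasurableSpace.injective_mapNatBool X)
  let p : ℕ → C(ℕ → Bool, ℝ) := TopologicalSpace.denseSeq _
  refine ⟨fun k => p k ∘ e, fun k => (p k).continuous.measurable.comp hem, ?_⟩
  rintro ν _ f hf ⟨B, hB⟩ ε hε
  obtain ⟨F, hF, hFf⟩ := he.exists_measurable_extend hf fun _ => inferInstance
  have hFe : ∀ x, F (e x) = f x := fun x => congrFun hFf x
  have : IsProbabilityMeasure (ν.map e) := Measure.isProbabilityMeasure_map hem.aemeasurable
  have hFi : Integrable F (ν.map e) := by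
    rw [he.integrable_map_iff, hFf]
    exact integrable_of_abs_le hf hB
  obtain ⟨g, hg, hgi⟩ := hFi.exists_boundedContinuous_integral_sub_le (half_pos hε)
  obtain ⟨k, hk⟩ := (TopologicalSpace.denseRange_denseSeq C(ℕ → Bool, ℝ)).exists_dist_lt
    g.toContinuousMap (half_pos hε)
  have hpi : Integrable (p k) (ν.map e) :=
    (BoundedContinuousFunction.mkOfCompact (p k)).integrable _
  have hgp : ∀ y, |g y - p k y| ≤ ε / 2 := fun y =>
    ((ContinuousMap.dist_apply_le_dist y).trans hk.le : dist (g.toContinuousMap y) (p k y) ≤ ε / 2)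
  refine ⟨k, (he.integrable_map_iff).1 hpi, ?_⟩
  calc ∫ x, |f x - (p k ∘ e) x| ∂ν = ∫ y, |F y - p k y| ∂(ν.map e) := by
        rw [he.integral_map]
        simp only [hFe, Function.comp_apply]
    _ ≤ ∫ y, (‖F y - g y‖ + ε / 2) ∂(ν.map e) := by
        refine integral_mono (hFi.sub hpi).abs ((hFi.sub hgi).norm.add (integrable_const _))
          fun y => ?_
        exact (abs_sub_le _ (g y) _).trans (add_le_add le_rfl (hgp y))
    _ = (∫ y, ‖F y - g y‖ ∂(ν.map e)) + ε / 2 := by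
        have hi : Integrable (fun y => ‖F y - g y‖) (ν.map e) := (hFi.sub hgi).norm
        rw [integral_add hi (integrable_const _)]
        simp
    _ ≤ ε := by linarith

/-- Truncation of a real number to `[-K, K]`. -/
def clip (K t : ℝ) : ℝ := max (-K) (min K t)

lemma abs_clip_le {K : ℝ} (hK : 0 ≤ K) (t : ℝ) : |clip K t| ≤ K :=
  abs_le.2 ⟨le_max_left _ _, max_le (by linarith) (min_le_left _ _)⟩

lemma clip_of_abs_le {K t : ℝ} (ht : |t| ≤ K) : clip K t = t := by
  rw [clip, min_eq_right (abs_le.1 ht).2, max_eq_right (abs_le.1 ht).1]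

lemma abs_clip_sub_clip_le (K s t : ℝ) : |clip K s - clip K t| ≤ |s - t| := by
  refine (abs_max_sub_max_le_max _ _ _ _).trans (max_le (by simp) ?_)
  exact (abs_min_sub_min_le_max _ _ _ _).trans (max_le (by simp) le_rfl)

lemma measurable_clip (K : ℝ) : Measurable (clip K) := by
  unfold clip; fun_prop

/-- A version of the conditional expectation with the same uniform bound as the function. -/
lemma exists_measurable_condExp_sub {X : Type*} {m : MeasurableSpace X}
    [mX : MeasurableSpace X] {μ : Measure X} [IsProbabilityMeasure μ] (hm : m ≤ mX) {f : X → ℝ}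
    (hf : Measurable f) {K : ℝ} (hK0 : 0 ≤ K) (hK : ∀ x, |f x| ≤ K) :
    ∃ g : X → ℝ, Measurable[m] g ∧ (∀ x, |g x| ≤ K) ∧ μ[fun x => f x - g x | m] =ᵐ[μ] 0 := by
  have hgm : Measurable[m] fun x => clip K (μ[f | m] x) :=
    (measurable_clip K).comp stronglyMeasurable_condExp.measurable
  refine ⟨fun x => clip K (μ[f | m] x), hgm, fun x => abs_clip_le hK0 _, ?_⟩
  have hbd := ae_bdd_abs_condExp_of_ae_bdd_abs (m := m) (f := f) (ae_of_all μ hK)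
  have hgi : Integrable (fun x => clip K (μ[f | m] x)) μ :=
    integrable_of_abs_le (hgm.mono hm le_rfl) fun x => abs_clip_le hK0 _
  refine (condExp_sub (integrable_of_abs_le hf hK) hgi m).trans ?_
  rw [condExp_of_stronglyMeasurable hm hgm.stronglyMeasurable hgi]
  filter_upwards [hbd] with x hx
  simp only [Pi.sub_apply, Pi.zero_apply]
  rw [clip_of_abs_le hx, sub_self]

theorem ergodic_components_of_magic_system_are_magic
    {X : Type*} [mX : MeasurableSpace X] [StandardBorelSpace X]
    [MeasurableSpace.CountablyGenerated X]
    (μ : Measure X) [IsProbabilityMeasure μ]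
    (T₁ T₂ : X ≃ᵐ X)
    (h₁ : MeasurePreserving T₁ μ μ) (h₂ : MeasurePreserving T₂ μ μ)
    (hcomm : ∀ x, T₁ (T₂ x) = T₂ (T₁ x))
    (hmagic : IsMagic μ T₁ T₂)
    -- the ergodic decomposition `x ↦ μₓ` of `μ` under `T₁` and `T₂`
    (μx : X → Measure X)
    (hprob : ∀ x, IsProbabilityMeasure (μx x))
    (hinv1 : ∀ x, MeasurePreserving T₁ (μx x) (μx x))
    (hinv2 : ∀ x, MeasurePreserving T₂ (μx x) (μx x))
    (herg : ∀ x, ∀ s : Set X, MeasurableSet s → T₁ ⁻¹' s = s → T₂ ⁻¹' s = s →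
      μx x s = 0 ∨ μx x s = 1)
    (hmeasfam : Measurable[invSigma ⇑T₁ ⊓ invSigma ⇑T₂] μx)
    (hdecomp : ∀ g : X → ℝ, Measurable g → (∃ C : ℝ, ∀ x, |g x| ≤ C) →
      ∀ᵐ x ∂μ, (μ[g | invSigma ⇑T₁ ⊓ invSigma ⇑T₂]) x = ∫ y, g y ∂(μx x)) :
    ∀ᵐ x ∂μ, IsMagic (μx x) T₁ T₂ := by
  have hc : Function.Commute T₁ T₂ := hcomm
  have hW := invSigma_sup_le T₁ T₂
  obtain ⟨q, hq, hdense⟩ := exists_seq_dense_L1 X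
  let r : ℕ → ℕ → X → ℝ := fun n k x => clip n (q k x)
  have hr : ∀ n k, Measurable (r n k) := fun n k => (measurable_clip n).comp (hq k)
  have hrn : ∀ n k x, |r n k x| ≤ n := fun n k x => abs_clip_le (Nat.cast_nonneg n) _
  choose s hs hsn hrs using fun n k =>
    exists_measurable_condExp_sub (μ := μ) hW (hr n k) (Nat.cast_nonneg n) (hrn n k)
  have hsm : ∀ n k, Measurable (s n k) := fun n k => (hs n k).mono hW le_rfl
  have hhm : ∀ n k, Measurable fun x => r n k x - s n k x := fun n k => (hr n k).sub (hsm n k)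
  have hhn : ∀ n k x, |r n k x - s n k x| ≤ 2 * n := fun n k x => by
    linarith [abs_sub (r n k x) (s n k x), hrn n k x, hsn n k x]
  have hae : ∀ᵐ x ∂μ, ∀ n k, HasBoxAvg (μx x) T₁ T₂ (fun x => r n k x - s n k x) 0 :=
    ae_all_iff.2 fun n => ae_all_iff.2 fun k =>
      HasBoxAvg.ae_of_disintegration h₁ h₂ hc (inf_le_left.trans (invSigma_le T₁)) hprob hinv1
        hinv2 hdecomp (hhm n k) (hhn n k) (hmagic _ (hhm n k) ⟨_, hhn n k⟩ (hrs n k))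
  filter_upwards [hae] with x hx
  rintro f hf ⟨B, hB⟩ hf0
  obtain ⟨n, hn⟩ := exists_nat_ge B
  have hfn : ∀ y, |f y| ≤ n := fun y => (hB y).trans hn
  have hprobx := hprob x
  refine hasBoxAvg_zero_of_approx (hinv1 x) (hinv2 x) hc hf (K := 2 * n)
    (fun y => by linarith [hfn y, abs_nonneg (f y)]) fun ε hε => ?_
  obtain ⟨k, hqi, hk⟩ := hdense (μx x) f hf ⟨B, hB⟩ (ε / 2) (half_pos hε)
  refine ⟨_, hhm n k, hhn n k, hx n k, ?_⟩
  have hfi : Integrable f (μx x) := integrable_of_abs_le hf hB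
  have hri : Integrable (r n k) (μx x) := integrable_of_abs_le (hr n k) (hrn n k)
  have hsi : Integrable (s n k) (μx x) := integrable_of_abs_le (hsm n k) (hsn n k)
  have hfr : ∫ y, |f y - r n k y| ∂(μx x) ≤ ε / 2 := by
    refine (integral_mono (hfi.sub hri).abs (hfi.sub hqi).abs fun y => ?_).trans hk
    have := abs_clip_sub_clip_le n (f y) (q k y)
    rwa [clip_of_abs_le (hfn y)] at this
  have hsle : ∫ y, |s n k y| ∂(μx x) ≤ ε / 2 := by
    have h0 := HasBoxAvg.condExp_ae_eq_zero (hinv1 x) (hinv2 x) hc (hhm n k) (hhn n k) (hx n k)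
    have h1 := condExp_sub hri hsi (invSigma T₁ ⊔ invSigma T₂)
    rw [condExp_of_stronglyMeasurable hW (hs n k).stronglyMeasurable hsi] at h1
    have h2 := condExp_sub hfi hri (invSigma T₁ ⊔ invSigma T₂)
    have heq : (fun y => |s n k y|) =ᵐ[μx x]
        fun y => |(μx x)[f - r n k | invSigma T₁ ⊔ invSigma T₂] y| := by
      filter_upwards [h0, h1, h2, hf0] with y e0 e1 e2 e3
      have e0' : (μx x)[r n k - s n k | invSigma T₁ ⊔ invSigma T₂] y = 0 := e0
      rw [e0', Pi.sub_apply] at e1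
      rw [e2, Pi.sub_apply, e3, Pi.zero_apply, zero_sub, abs_neg, sub_eq_zero.1 e1.symm]
    rw [integral_congr_ae heq]
    exact (integral_abs_condExp_le _).trans hfr
  calc ∫ y, |f y - (r n k y - s n k y)| ∂(μx x)
      ≤ ∫ y, (|f y - r n k y| + |s n k y|) ∂(μx x) := by
        refine integral_mono (hfi.sub (hri.sub hsi)).abs ((hfi.sub hri).abs.add hsi.abs)
          fun y => ?_
        have := abs_add_le (f y - r n k y) (s n k y)
        rwa [sub_add] at this
    _ = (∫ y, |f y - r n k y| ∂(μx x)) + ∫ y, |s n k y| ∂(μx x) :=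
        integral_add (hfi.sub hri).abs hsi.abs
    _ ≤ ε := by linarith
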